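/- The smallest ℚ-linear subspace of ℚRT(S) that contains all trees with exactly one non-root vertex (i.e. the tree with two vertices whose non-root vertex is labelled s, for each s ∈ S) and is closed under both products ⋆₁ and ⋆₂ contains every S-labelled planar rooted tree having at least one non-root vertex. In other words, as an algebra with the two products ⋆₁ and ⋆₂, the span of trees of positive degree is generated by the elements of degree 1. -/

import Mathlib

/-! S-labelled planar rooted trees: a tree is a root together with a finite ordered
list of branches, a branch being a label in `S` together with a subtree. -/

mutual
/-- An `S`-labelled planar rooted tree: an unlabelled root with an ordered list of branches. -/
inductive PTree (S : Type) : Type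
  | node : Branches S → PTree S

/-- An ordered list of branches; each branch is a label in `S` together with a subtree. -/
inductive Branches (S : Type) : Type
  | nil : Branches S
  | cons : S → PTree S → Branches S → Branches S
end

variable {S : Type}

/-- Concatenation of branch lists. -/
def Branches.append : Branches S → Branches S → Branches S
  | .nil, c => c
  | .cons s t rest, c => .cons s t (Branches.append rest c)

/-- The number of branches in a list. -/
def Branches.len : Branches S → ℕ
  | .nil => 0
  | .cons _ _ rest => Branches.len rest + 1

mutual
/-- The list of arities (numbers of children) of the vertices of a tree,
in preorder (root first, then the subtrees from left to right). -/
def PTree.arities : PTree S → List ℕ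
  | .node b => Branches.len b :: Branches.arities b

/-- The concatenated preorder arity lists of the subtrees of a branch list. -/
def Branches.arities : Branches S → List ℕ
  | .nil => []
  | .cons _ t rest => PTree.arities t ++ Branches.arities rest
end

/-- The number of vertices of a tree (including the root). -/
def PTree.nv (T : PTree S) : ℕ := T.arities.length

/-- The degree of a tree: its number of non-root vertices. -/
def PTree.deg (T : PTree S) : ℕ := T.nv - 1

/-- The number of children of the root. -/
def PTree.rootArity : PTree S → ℕ
  | .node b => Branches.len b

/-- The list of branches at the root. -/
def PTree.branches : PTree S → Branches S
  | .node b => b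

mutual
/-- Graft, for every vertex `v` of the tree (indexed in preorder), the branch list `φ v`
at `v`, placing the grafted branches to the left of the existing children of `v`. -/
def PTree.graft : PTree S → (ℕ → Branches S) → PTree S
  | .node b, φ => .node (Branches.append (φ 0) (Branches.graftB b (fun n => φ (n + 1))))

/-- Graft branch lists into all subtrees of a branch list, the vertex indices being
distributed in preorder. -/
def Branches.graftB : Branches S → (ℕ → Branches S) → Branches S
  | .nil, _ => .nil
  | .cons s t rest, φ =>
      .cons s (PTree.graft t φ)
        (Branches.graftB rest (fun n => φ (n + (PTree.arities t).length)))
end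

/-- The sublist of a branch list consisting of the branches whose position (counted from 0)
satisfies the predicate, in their original order. -/
def Branches.filterIdx : Branches S → (ℕ → Bool) → Branches S
  | .nil, _ => .nil
  | .cons s t rest, p =>
      if p 0 then .cons s t (Branches.filterIdx rest (fun n => p (n + 1)))
      else Branches.filterIdx rest (fun n => p (n + 1))

/-- The tree `T₁ ∘^f T₂` for a function `f` from the root-branches of `T₁` to the
(preorder-indexed) vertices of `T₂`: graft, at each vertex `v` of `T₂`, the branches of
`T₁` lying over `v`, in order, to the left of the existing children of `v`. -/
def graftAlong (T₁ T₂ : PTree S) (f : Fin T₁.rootArity → Fin T₂.nv) : PTree S :=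
  T₂.graft fun v => T₁.branches.filterIdx fun i =>
    if h : i < T₁.rootArity then decide ((f ⟨i, h⟩ : ℕ) = v) else false

/-- The product `T₁ ⋆₁ T₂` of two trees: the sum of `T₁ ∘^f T₂` over all functions `f`
from the root-branches of `T₁` to the vertices of `T₂`. -/
noncomputable def treeProd1 (T₁ T₂ : PTree S) : PTree S →₀ ℚ :=
  ∑ f : Fin T₁.rootArity → Fin T₂.nv, Finsupp.single (graftAlong T₁ T₂ f) 1

/-- Vertex number `v` (in preorder) of `T` is internal, i.e. has at least one child. -/
def PTree.isInternal (T : PTree S) (v : ℕ) : Prop := T.arities.getD v 0 ≠ 0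

open Classical in
/-- The product `T₁ ⋆₂ T₂` of two trees: the sum of `T₁ ∘^g T₂` over all functions `g`
from the root-branches of `T₁` to the internal vertices of `T₂`. -/
noncomputable def treeProd2 (T₁ T₂ : PTree S) : PTree S →₀ ℚ :=
  ∑ f : Fin T₁.rootArity → Fin T₂.nv,
    if ∀ i, T₂.isInternal (f i) then Finsupp.single (graftAlong T₁ T₂ f) 1 else 0

/-- The bilinear extension to `ℚRT(S)` of a product of trees with values in `ℚRT(S)`. -/
noncomputable def starLin (P : PTree S → PTree S → (PTree S →₀ ℚ)) :
    (PTree S →₀ ℚ) →ₗ[ℚ] (PTree S →₀ ℚ) →ₗ[ℚ] (PTree S →₀ ℚ) :=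
  Finsupp.lsum ℚ fun T₁ =>
    LinearMap.toSpanSingleton ℚ _
      (Finsupp.lsum ℚ fun T₂ => LinearMap.toSpanSingleton ℚ _ (P T₁ T₂))

/-- The first product `⋆₁` (the Grossman–Larson product) on `ℚRT(S)`. -/
noncomputable def star1 (x y : PTree S →₀ ℚ) : PTree S →₀ ℚ := starLin treeProd1 x y

/-- The second product `⋆₂` on `ℚRT(S)`. -/
noncomputable def star2 (x y : PTree S →₀ ℚ) : PTree S →₀ ℚ := starLin treeProd2 x y


/-- The tree with two vertices whose non-root vertex is labelled `s`. -/
def leafTree {S : Type} (s : S) : PTree S :=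
  PTree.node (Branches.cons s (PTree.node Branches.nil) Branches.nil)

namespace Branches

/-- The number of vertices contained in a branch list. -/
def size (b : Branches S) : ℕ := b.arities.length

/-- The concatenation of the reversal of the first branch list with the second. -/
def reverseAppend : Branches S → Branches S → Branches S
  | .nil, c => c
  | .cons s t r, c => reverseAppend r (.cons s t c)

@[simp] theorem size_nil : (nil : Branches S).size = 0 := by simp [size, arities]

@[simp] theorem size_cons (s : S) (t : PTree S) (r : Branches S) :
    (cons s t r).size = t.nv + r.size := by simp [size, arities, PTree.nv]

@[simp] theorem nv_node (b : Branches S) : (PTree.node b).nv = b.size + 1 := by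
  simp [size, PTree.arities, PTree.nv]

theorem append_nil : ∀ b : Branches S, b.append nil = b
  | .nil => rfl
  | .cons s t r => by simp [append, append_nil r]

@[simp] theorem len_append : ∀ a b : Branches S, (a.append b).len = a.len + b.len
  | .nil, b => by simp [append, len]
  | .cons s t r, b => by simp [append, len, len_append r b]; omega

@[simp] theorem size_append : ∀ a b : Branches S, (a.append b).size = a.size + b.size
  | .nil, b => by simp [append]
  | .cons s t r, b => by simp [append, size_append r b, Nat.add_assoc]

@[simp] theorem len_reverseAppend : ∀ a b : Branches S,
    (a.reverseAppend b).len = a.len + b.len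
  | .nil, b => by simp [reverseAppend, len]
  | .cons s t r, b => by simp [reverseAppend, len, len_reverseAppend r]; omega

@[simp] theorem size_reverseAppend : ∀ a b : Branches S,
    (a.reverseAppend b).size = a.size + b.size
  | .nil, b => by simp [reverseAppend]
  | .cons s t r, b => by simp [reverseAppend, size_reverseAppend r]; omega

theorem reverseAppend_reverseAppend : ∀ a b c : Branches S,
    (a.reverseAppend b).reverseAppend c = b.reverseAppend (a.append c)
  | .nil, _, _ => rfl
  | .cons s t r, b, c => by
    simp [reverseAppend, append, reverseAppend_reverseAppend r]

theorem size_pos_of_len_pos : ∀ b : Branches S, 0 < b.len → 0 < b.size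
  | .nil, h => by simp [len] at h
  | .cons s (.node c) r, _ => by simp

theorem exists_eq_append_last : ∀ b : Branches S, 0 < b.len →
    ∃ U s V, b = append U (cons s (PTree.node V) nil)
  | .nil, h => by simp [len] at h
  | .cons s (.node V) .nil, _ => ⟨nil, s, V, rfl⟩
  | .cons s t (.cons s' t' r), _ => by
    obtain ⟨U, s'', V, h⟩ := exists_eq_append_last (cons s' t' r) (by simp [len])
    exact ⟨cons s t U, s'', V, by simp [append, h]⟩

/-- The branches of a list whose value under `g` is `v`, in order. -/
def fiber (U : Branches S) {k : ℕ} (g : Fin k → ℕ) (v : ℕ) : Branches S :=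
  U.filterIdx fun i => if h : i < k then decide (g ⟨i, h⟩ = v) else false

@[simp] theorem fiber_nil {k : ℕ} (g : Fin k → ℕ) (v : ℕ) :
    fiber (nil : Branches S) g v = nil := rfl

theorem fiber_cons (s : S) (t : PTree S) (r : Branches S) {k : ℕ}
    (g : Fin (k + 1) → ℕ) (v : ℕ) :
    fiber (cons s t r) g v =
      if g 0 = v then cons s t (fiber r (fun i => g i.succ) v)
      else fiber r (fun i => g i.succ) v := by
  by_cases h : g 0 = v <;> simp [fiber, filterIdx, Fin.succ, h]

theorem fiber_eq_nil : ∀ (U : Branches S) {k : ℕ} (_ : U.len = k) (g : Fin k → ℕ) (v : ℕ),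
    (∀ i, g i ≠ v) → fiber U g v = nil
  | .nil, _, _, _, _, _ => rfl
  | .cons s t r, 0, hk, _, _, _ => by simp [len] at hk
  | .cons s t r, k + 1, hk, g, v, h => by
    rw [fiber_cons, if_neg (h _), fiber_eq_nil r (Nat.succ.inj hk) _ v fun i => h _]

theorem fiber_eq_self : ∀ (U : Branches S) {k : ℕ} (_ : U.len = k) (g : Fin k → ℕ) (v : ℕ),
    (∀ i, g i = v) → fiber U g v = U
  | .nil, _, _, _, _, _ => rfl
  | .cons s t r, 0, hk, _, _, _ => by simp [len] at hk
  | .cons s t r, k + 1, hk, g, v, h => by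
    rw [fiber_cons, if_pos (h _), fiber_eq_self r (Nat.succ.inj hk) _ v fun i => h _]

theorem sum_size_fiber_le : ∀ (U : Branches S) {k : ℕ} (_ : U.len = k) (g : Fin k → ℕ) (n : ℕ),
    ∑ v ∈ Finset.range n, (fiber U g v).size ≤ U.size
  | .nil, _, _, _, _ => by simp
  | .cons s t r, 0, hk, _, _ => by simp [len] at hk
  | .cons s t r, k + 1, hk, g, n => by
    have ih := sum_size_fiber_le r (Nat.succ.inj hk) (fun i => g i.succ) n
    have h : ∀ v, (fiber (cons s t r) g v).size =
        (if g 0 = v then t.nv else 0) + (fiber r (fun i => g i.succ) v).size := by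
      intro v
      rw [fiber_cons]
      split <;> simp
    have h' : ∑ v ∈ Finset.range n, (if g 0 = v then t.nv else 0) ≤ t.nv := by
      rw [Finset.sum_ite_eq]
      split <;> simp
    simp only [h, Finset.sum_add_distrib, size_cons]
    omega

theorem len_fiber_add_len_fiber_le : ∀ (U : Branches S) {k : ℕ} (_ : U.len = k)
    (g : Fin k → ℕ), (fiber U g 0).len + (fiber U g 1).len ≤ U.len
  | .nil, _, _, _ => by simp [len]
  | .cons s t r, 0, hk, _ => by simp [len] at hk
  | .cons s t r, k + 1, hk, g => by
    have ih := len_fiber_add_len_fiber_le r (Nat.succ.inj hk) (fun i => g i.succ)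
    rw [fiber_cons, fiber_cons]
    split_ifs <;> simp only [len] <;> omega

theorem len_fiber_add_len_fiber_lt : ∀ (U : Branches S) {k : ℕ} (_ : U.len = k)
    (g : Fin k → ℕ), (∃ i, 2 ≤ g i) → (fiber U g 0).len + (fiber U g 1).len < U.len
  | .nil, _, hk, _, ⟨i, _⟩ => by
    subst hk
    exact i.elim0
  | .cons s t r, 0, hk, _, _ => by simp [len] at hk
  | .cons s t r, k + 1, hk, g, ⟨i, hi⟩ => by
    have ih := len_fiber_add_len_fiber_le r (Nat.succ.inj hk) (fun i => g i.succ)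
    rw [fiber_cons, fiber_cons]
    by_cases h0 : 2 ≤ g 0
    · rw [if_neg (by omega), if_neg (by omega)]
      simp only [len]
      omega
    · obtain ⟨j, rfl⟩ : ∃ j : Fin k, j.succ = i := by
        refine Fin.exists_succ_eq.2 ?_
        rintro rfl
        exact h0 hi
      have ih' := len_fiber_add_len_fiber_lt r (Nat.succ.inj hk) (fun i => g i.succ) ⟨j, hi⟩
      split_ifs <;> simp only [len] <;> omega

/-- The sum of `Φ a b` over all splittings of a branch list into a sublist `a` and the
complementary sublist `b`. -/
def splitSum {M : Type*} [AddCommGroup M] :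
    Branches S → (Branches S → Branches S → M) → M
  | .nil, Φ => Φ nil nil
  | .cons s t r, Φ =>
      splitSum r (fun a b => Φ (cons s t a) b) + splitSum r (fun a b => Φ a (cons s t b))

theorem splitSum_sub {M : Type*} [AddCommGroup M] : ∀ (U : Branches S)
    (Φ Ψ : Branches S → Branches S → M),
    splitSum U (fun a b => Φ a b - Ψ a b) = splitSum U Φ - splitSum U Ψ
  | .nil, _, _ => rfl
  | .cons s t r, Φ, Ψ => by
    simp only [splitSum]
    rw [splitSum_sub r, splitSum_sub r]
    abel

theorem splitSum_neg {M : Type*} [AddCommGroup M] : ∀ (U : Branches S)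
    (Φ : Branches S → Branches S → M),
    splitSum U (fun a b => - Φ a b) = - splitSum U Φ
  | .nil, _ => rfl
  | .cons s t r, Φ => by
    simp only [splitSum]
    rw [splitSum_neg r, splitSum_neg r]
    abel

theorem splitSum_mem {M : Type*} [AddCommGroup M] [Module ℚ M] (q : Submodule ℚ M) :
    ∀ (U : Branches S) (Φ : Branches S → Branches S → M),
    (∀ a b, a.len + b.len = U.len → a.size + b.size = U.size → Φ a b ∈ q) →
    splitSum U Φ ∈ q
  | .nil, _, h => h _ _ rfl (by simp)
  | .cons s t r, Φ, h => by
    refine q.add_mem (splitSum_mem q r _ fun a b h1 h2 => h _ _ ?_ ?_)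
      (splitSum_mem q r _ fun a b h1 h2 => h _ _ ?_ ?_) <;>
    simp only [len, size_cons] <;> omega

theorem splitSum_sub_mem {M : Type*} [AddCommGroup M] [Module ℚ M] (q : Submodule ℚ M) :
    ∀ (U : Branches S) (Φ : Branches S → Branches S → M),
    (∀ a b, 0 < b.len → a.len + b.len = U.len → a.size + b.size = U.size → Φ a b ∈ q) →
    splitSum U Φ - Φ U nil ∈ q
  | .nil, _, h => by simp [splitSum]
  | .cons s t r, Φ, h => by
    have h1 := splitSum_sub_mem q r (fun a b => Φ (cons s t a) b) fun a b h0 h1 h2 =>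
      h _ _ h0 (by simp only [len]; omega) (by simp only [size_cons]; omega)
    have h2 := splitSum_mem q r (fun a b => Φ a (cons s t b)) fun a b h1 h2 =>
      h _ _ (by simp [len]) (by simp only [len]; omega) (by simp only [size_cons]; omega)
    convert q.add_mem h1 h2 using 1
    simp only [splitSum]
    abel

theorem splitSum_alternating_reverseAppend {M : Type*} [AddCommGroup M] [Module ℚ M]
    (U : Branches S) (hU : 0 < U.len) (E : Branches S → M) :
    splitSum U (fun a b => (-1 : ℚ) ^ a.len • E (a.reverseAppend b)) = 0 := by
  match U, hU with
  | .nil, h => simp [len] at h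
  | .cons s t r, _ =>
    simp only [splitSum, reverseAppend, len, pow_succ, mul_neg, mul_one, neg_smul]
    rw [splitSum_neg, neg_add_cancel]

theorem sum_fiber_eq_splitSum {M : Type*} [AddCommGroup M] : ∀ (U : Branches S) {k : ℕ}
    (_ : U.len = k) (Φ : Branches S → Branches S → M),
    ∑ h : Fin k → Bool, Φ (fiber U (fun i => (h i).toNat) 0)
      (fiber U (fun i => (h i).toNat) 1) = splitSum U Φ
  | .nil, 0, _, Φ => by simp [splitSum]
  | .nil, k + 1, hk, _ => by simp [len] at hk
  | .cons s t r, 0, hk, _ => by simp [len] at hk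
  | .cons s t r, k + 1, hk, Φ => by
    simp only [splitSum]
    rw [← sum_fiber_eq_splitSum r (Nat.succ.inj hk), ← sum_fiber_eq_splitSum r (Nat.succ.inj hk),
      ← (Fin.consEquiv fun _ => Bool).sum_comp, Fintype.sum_prod_type]
    simp only [Fin.consEquiv, Equiv.coe_fn_mk, fiber_cons]
    rw [Fintype.sum_bool, add_comm]
    simp

end Branches

open Branches

mutual
theorem PTree.nv_graft : ∀ (T : PTree S) (φ : ℕ → Branches S),
    (T.graft φ).nv = T.nv + ∑ v ∈ Finset.range T.nv, (φ v).size
  | .node b, φ => by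
    rw [PTree.graft, nv_node, size_append, Branches.size_graftB b, nv_node,
      Finset.sum_range_succ']
    omega

theorem Branches.size_graftB : ∀ (b : Branches S) (φ : ℕ → Branches S),
    (b.graftB φ).size = b.size + ∑ v ∈ Finset.range b.size, (φ v).size
  | .nil, φ => by simp [Branches.graftB]
  | .cons s t r, φ => by
    rw [Branches.graftB, size_cons, size_cons, PTree.nv_graft t, Branches.size_graftB r,
      Finset.sum_range_add]
    simp only [PTree.nv, add_comm]
    omega
end

mutual
theorem PTree.graft_nil : ∀ (T : PTree S), T.graft (fun _ => .nil) = T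
  | .node b => by rw [PTree.graft, Branches.graftB_nil b]; rfl

theorem Branches.graftB_nil : ∀ (b : Branches S), b.graftB (fun _ => .nil) = b
  | .nil => rfl
  | .cons s t r => by rw [Branches.graftB, PTree.graft_nil t, Branches.graftB_nil r]
end

theorem Branches.len_graftB : ∀ (b : Branches S) (φ : ℕ → Branches S),
    (b.graftB φ).len = b.len
  | .nil, _ => rfl
  | .cons s t r, φ => by simp [Branches.graftB, len, Branches.len_graftB r]

/-- The tree whose root has a single child labelled `s`, below which `V` is grafted. -/
def planted (s : S) (V : Branches S) : PTree S :=
  .node (.cons s (.node V) .nil)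

/-- The basis element of the tree with branch list `U`, followed by a last branch labelled `s`
with subtree `V`. -/
noncomputable def withLast (U : Branches S) (s : S) (V : Branches S) : PTree S →₀ ℚ :=
  Finsupp.single (.node (U.append (.cons s (.node V) .nil))) 1

theorem star1_single (T₁ T₂ : PTree S) :
    star1 (Finsupp.single T₁ 1) (Finsupp.single T₂ 1) = treeProd1 T₁ T₂ := by
  simp [star1, starLin, LinearMap.toSpanSingleton]

theorem star2_single (T₁ T₂ : PTree S) :
    star2 (Finsupp.single T₁ 1) (Finsupp.single T₂ 1) = treeProd2 T₁ T₂ := by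
  simp [star2, starLin, LinearMap.toSpanSingleton]

@[simp] theorem nv_planted (s : S) (V : Branches S) : (planted s V).nv = V.size + 2 := by
  simp [planted]

theorem single_graftAlong_planted (U V : Branches S) (s : S)
    (f : Fin (PTree.node U).rootArity → Fin (planted s V).nv) :
    Finsupp.single (graftAlong (.node U) (planted s V) f) (1 : ℚ) =
      withLast (fiber U (fun i => f i) 0) s ((fiber U (fun i => f i) 1).append
        (V.graftB fun v => fiber U (fun i => f i) (v + 2))) := rfl

/-- A sum over all maps to `Fin N` agrees, modulo a submodule containing the terms of all
maps that take a value other than `0` and `1`, with the sum over maps to `{0, 1}`. -/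
theorem sum_sub_sum_bool_mem {M : Type*} [AddCommGroup M] [Module ℚ M] (q : Submodule ℚ M)
    {k N : ℕ} (hN : 2 ≤ N) (G : (Fin k → Fin N) → M)
    (hG : ∀ f, (∃ i, 2 ≤ (f i : ℕ)) → G f ∈ q) :
    ∑ f, G f - ∑ h : Fin k → Bool,
      G (fun i => ⟨(h i).toNat, (Bool.toNat_lt (h i)).trans_le hN⟩) ∈ q := by
  classical
  set e : (Fin k → Bool) → (Fin k → Fin N) :=
    fun h i => ⟨(h i).toNat, (Bool.toNat_lt (h i)).trans_le hN⟩ with he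
  have hinj : Function.Injective e := by
    intro h h' hh
    funext i
    have := congrArg Fin.val (congrFun hh i)
    simp only [he] at this
    revert this
    cases h i <;> cases h' i <;> simp
  rw [← Finset.sum_image (s := Finset.univ) (g := e) (f := G) (fun a _ b _ h => hinj h),
    ← Finset.sum_sdiff (Finset.subset_univ (Finset.univ.image e)), add_sub_cancel_right]
  refine q.sum_mem fun f hf => hG f ?_
  by_contra! hlt
  refine (Finset.mem_sdiff.1 hf).2 (Finset.mem_image.2 ⟨fun i => decide ((f i : ℕ) = 1),
    Finset.mem_univ _, ?_⟩)
  funext i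
  have := hlt i
  ext
  simp only [he]
  by_cases h1 : (f i : ℕ) = 1
  · simp [h1]
  · simp [h1]; omega

theorem single_graftAlong_planted_bool (U V : Branches S) (s : S) (h : Fin (PTree.node U).rootArity → Bool)
    (hlt : ∀ i, (h i).toNat < (planted s V).nv) :
    Finsupp.single (graftAlong (.node U) (planted s V) fun i => ⟨(h i).toNat, hlt i⟩) (1 : ℚ) =
      withLast (fiber U (fun i => (h i).toNat) 0) s
        ((fiber U (fun i => (h i).toNat) 1).append V) := by
  rw [single_graftAlong_planted]
  have hnil : (fun v => fiber U (fun i => (h i).toNat) (v + 2)) = fun _ => nil := by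
    funext v
    refine fiber_eq_nil _ rfl _ _ fun i => ?_
    have := Bool.toNat_lt (h i)
    omega
  simp only [hnil, Branches.graftB_nil]

theorem treeProd1_leafTree (U : Branches S) (s : S) :
    treeProd1 (.node U) (leafTree s) = splitSum U fun a b => withLast a s b := by
  have h := sum_sub_sum_bool_mem (⊥ : Submodule ℚ (PTree S →₀ ℚ)) (k := (PTree.node U).rootArity)
    (N := (planted s nil).nv) (by simp)
    (fun f => Finsupp.single (graftAlong (.node U) (planted s nil) f) 1) (by
      rintro f ⟨i, hi⟩
      have := (f i).isLt
      simp only [nv_planted, size_nil] at this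
      omega)
  rw [Submodule.mem_bot, sub_eq_zero] at h
  refine h.trans ?_
  simp only [single_graftAlong_planted_bool, append_nil]
  exact sum_fiber_eq_splitSum U rfl fun a b => withLast a s b

theorem treeProd2_leafTree (U : Branches S) (s : S) :
    treeProd2 (.node U) (leafTree s) = withLast U s nil := by
  classical
  change ∑ f : Fin (PTree.node U).rootArity → Fin (planted s nil).nv,
    (if ∀ i, (planted s nil).isInternal (f i) then
      Finsupp.single (graftAlong (.node U) (planted s nil) f) (1 : ℚ) else 0) = _
  have hpos : 0 < (planted s (nil : Branches S)).nv := by simp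
  rw [Finset.sum_eq_single (fun _ => ⟨0, hpos⟩)]
  · rw [if_pos fun i => by simp [PTree.isInternal, planted, PTree.arities, len],
      single_graftAlong_planted]
    have h0 := fiber_eq_self U (k := (PTree.node U).rootArity) rfl (fun _ => 0) 0 fun _ => rfl
    have h1 := fiber_eq_nil U (k := (PTree.node U).rootArity) rfl (fun _ => 0) 1 (by simp)
    simp only [h0, h1]
    rfl
  · intro f _ hf
    rw [if_neg]
    intro hint
    refine hf (funext fun i => Fin.ext ?_)
    have hlt := (f i).isLt
    simp only [nv_planted, size_nil] at hlt
    by_contra hne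
    have h1 : (f i : ℕ) = 1 := by simp only at hne; omega
    have := hint i
    rw [h1] at this
    simp [PTree.isInternal, planted, PTree.arities, Branches.arities, len] at this
  · simp

theorem treeProd2_planted_sub_mem (q : Submodule ℚ (PTree S →₀ ℚ)) (U V : Branches S) (s : S)
    (hV : 0 < V.len)
    (hq : ∀ a b, 0 < b.len → a.len + b.len < U.len + V.len →
      a.size + b.size ≤ U.size + V.size → withLast a s b ∈ q) :
    treeProd2 (.node U) (planted s V) -
      splitSum U (fun a b => withLast a s (b.append V)) ∈ q := by
  classical
  have h := sum_sub_sum_bool_mem q (k := (PTree.node U).rootArity) (N := (planted s V).nv) (by simp)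
    (fun f => if ∀ i, (planted s V).isInternal (f i) then
      Finsupp.single (graftAlong (.node U) (planted s V) f) 1 else 0) (by
      intro f hf
      split_ifs
      swap
      · exact q.zero_mem
      rw [single_graftAlong_planted]
      have h1 := len_fiber_add_len_fiber_lt U (k := (PTree.node U).rootArity) rfl (fun i => f i) hf
      have h2 := sum_size_fiber_le U (k := (PTree.node U).rootArity) rfl (fun i => f i) (V.size + 2)
      rw [Finset.sum_range_succ', Finset.sum_range_succ'] at h2
      simp only [zero_add, add_assoc, Nat.reduceAdd] at h2
      apply hq
      · simp only [len_append, Branches.len_graftB]; omega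
      · simp only [len_append, Branches.len_graftB]; omega
      · simp only [size_append, Branches.size_graftB]; omega)
  rw [← sum_fiber_eq_splitSum U (k := (PTree.node U).rootArity) rfl]
  have hint : ∀ (h : Fin (PTree.node U).rootArity → Bool) (i : Fin (PTree.node U).rootArity),
      (planted s V).isInternal (h i).toNat := by
    intro h i
    cases h i <;>
      simp [PTree.isInternal, planted, PTree.arities, Branches.arities, len, hV.ne']
  simp only [hint, implies_true, if_true, single_graftAlong_planted_bool] at h
  convert h using 2
  exact Finset.sum_congr rfl fun f _ => by congr

section Generation

variable {p : Submodule ℚ (PTree S →₀ ℚ)} {N : ℕ}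

theorem withLast_sub_planted_mem {s : S} {m : ℕ}
    (hsplit : ∀ U V : Branches S, 0 < U.len → 0 < V.len → U.len + V.len = m →
      U.size + V.size ≤ N → splitSum U (fun a b => withLast a s (b.append V)) ∈ p) :
    ∀ (k : ℕ) (U V : Branches S), U.len = k → 0 < V.len → U.len + V.len = m →
      U.size + V.size ≤ N →
      withLast U s V -
        (-1 : ℚ) ^ U.len • Finsupp.single (planted s (U.reverseAppend V)) 1 ∈ p := by
  intro k
  induction k using Nat.strong_induction_on with
  | _ k ih =>
    intro U V hk hV hm hN
    rcases Nat.eq_zero_or_pos U.len with h0 | hpos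
    · match U, h0 with
      | .nil, _ => simp [withLast, planted, reverseAppend, append, len]
      | .cons _ _ _, h => simp [len] at h
    have h1 := splitSum_sub_mem p U (fun a b => withLast a s (b.append V) -
      (-1 : ℚ) ^ a.len • Finsupp.single (planted s (a.reverseAppend (b.append V))) 1)
      fun a b hb hl hs => ih a.len (by omega) a (b.append V) rfl
        (by simp; omega) (by simp; omega) (by simp; omega)
    rw [splitSum_sub] at h1
    have h2 : ∀ a b : Branches S,
        a.reverseAppend (b.append V) = (a.reverseAppend b).append V := by
      intro a
      induction a using Branches.rec (motive_1 := fun _ => True) with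
      | node => trivial
      | nil => intro b; rfl
      | cons s t r _ ih => intro b; exact ih (.cons s t b)
    simp only [h2] at h1
    rw [splitSum_alternating_reverseAppend U hpos
      fun b => Finsupp.single (planted s (b.append V)) (1 : ℚ), sub_zero, ← h2] at h1
    exact (Submodule.sub_mem_iff_right p (hsplit U V hpos hV hm hN)).1 h1

theorem withLast_mem
    (hmul1 : ∀ x ∈ p, ∀ y ∈ p, star1 x y ∈ p)
    (hmul2 : ∀ x ∈ p, ∀ y ∈ p, star2 x y ∈ p)
    (hN : ∀ b : Branches S, 0 < b.len → b.size ≤ N → Finsupp.single (.node b) (1 : ℚ) ∈ p)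
    (s : S) (hleaf : Finsupp.single (leafTree s) (1 : ℚ) ∈ p) (m : ℕ) :
    ∀ U V : Branches S, 0 < V.len → U.len + V.len ≤ m → U.size + V.size ≤ N →
      withLast U s V ∈ p := by
  induction m with
  | zero => intro U V hV h; omega
  | succ m ih =>
    have hsplit : ∀ U V : Branches S, 0 < U.len → 0 < V.len → U.len + V.len = m + 1 →
        U.size + V.size ≤ N → splitSum U (fun a b => withLast a s (b.append V)) ∈ p := by
      intro U V hU hV hl hs
      have hUs := size_pos_of_len_pos U hU
      have h := treeProd2_planted_sub_mem p U V s hV fun a b h0 h1 h2 =>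
        ih a b h0 (by omega) (by omega)
      refine (Submodule.sub_mem_iff_right p ?_).1 h
      rw [← star2_single]
      exact hmul2 _ (hN U hU (by omega)) _ (hN _ (by simp [len]) (by simp; omega))
    have hsub := withLast_sub_planted_mem hsplit
    have hrev : ∀ F : Branches S, F.len = m + 1 → F.size ≤ N →
        Finsupp.single (planted s (F.reverseAppend nil)) (1 : ℚ) ∈ p := by
      intro F hl hs
      have hF : Finsupp.single (.node F) (1 : ℚ) ∈ p := hN F (by omega) hs
      have h1 := hmul1 _ hF _ hleaf
      have h2 := hmul2 _ hF _ hleaf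
      rw [star1_single, treeProd1_leafTree] at h1
      rw [star2_single, treeProd2_leafTree] at h2
      have h3 := splitSum_sub_mem p F (fun a b => withLast a s b -
        (-1 : ℚ) ^ a.len • Finsupp.single (planted s (a.reverseAppend b)) 1)
        fun a b hb hl' hs' => hsub a.len a b rfl hb (by omega) (by omega)
      rw [splitSum_sub, splitSum_alternating_reverseAppend F (by omega)
        fun b => Finsupp.single (planted s b) (1 : ℚ), sub_zero] at h3
      have h4 := (Submodule.sub_mem_iff_right p h2).1
        ((Submodule.sub_mem_iff_right p h1).1 h3)
      exact (p.smul_mem_iff (pow_ne_zero _ (by norm_num))).1 h4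
    intro U V hV hl hs
    rcases Nat.lt_or_ge (U.len + V.len) (m + 1) with hlt | hge
    · exact ih U V hV (by omega) hs
    have h5 := hrev ((U.reverseAppend V).reverseAppend nil) (by simp [len]; omega)
      (by simp; omega)
    rw [reverseAppend_reverseAppend, append_nil, reverseAppend] at h5
    exact (Submodule.sub_mem_iff_left p (p.smul_mem _ h5)).1
      (hsub U.len U V rfl hV (by omega) hs)

end Generation

/-- Any `ℚ`-linear subspace of `ℚRT(S)` containing all trees with exactly one non-root
vertex and closed under both products `⋆₁` and `⋆₂` contains every `S`-labelled planar
rooted tree of positive degree: as an algebra with the two products `⋆₁` and `⋆₂`, the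
span of trees of positive degree is generated by the elements of degree `1`. -/
theorem generated_in_degree_one (S : Type) (p : Submodule ℚ (PTree S →₀ ℚ))
    (hgen : ∀ s : S, Finsupp.single (leafTree s) (1 : ℚ) ∈ p)
    (hmul1 : ∀ x ∈ p, ∀ y ∈ p, star1 x y ∈ p)
    (hmul2 : ∀ x ∈ p, ∀ y ∈ p, star2 x y ∈ p) :
    ∀ T : PTree S, 1 ≤ T.deg → Finsupp.single T (1 : ℚ) ∈ p := by
  have main : ∀ n : ℕ, ∀ b : Branches S, 0 < b.len → b.size ≤ n →
      Finsupp.single (.node b) (1 : ℚ) ∈ p := by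
    intro n
    induction n with
    | zero =>
      intro b hb hs
      have := size_pos_of_len_pos b hb
      omega
    | succ n ih =>
      intro b hb hs
      obtain ⟨U, s, V, rfl⟩ := exists_eq_append_last b hb
      simp only [size_append, size_cons, nv_node, size_nil] at hs
      rcases Nat.eq_zero_or_pos V.len with hV | hV
      · match V, hV with
        | .cons _ _ _, h => simp [Branches.len] at h
        | .nil, _ =>
          rcases Nat.eq_zero_or_pos U.len with hU | hU
          · match U, hU with
            | .cons _ _ _, h => simp [Branches.len] at h
            | .nil, _ => exact hgen s
          · have h := hmul2 _ (ih U hU (by omega)) _ (hgen s)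
            rwa [star2_single, treeProd2_leafTree] at h
      · exact withLast_mem hmul1 hmul2 ih s (hgen s) _ U V hV le_rfl (by omega)
  rintro ⟨b⟩ hT
  simp only [PTree.deg, nv_node, Nat.add_sub_cancel] at hT
  refine main _ b ?_ le_rfl
  match b, hT with
  | .nil, h => simp at h
  | .cons _ _ _, _ => simp [Branches.len]
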